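/- arXiv:2202.07331 — 6 statements merged into one kernel-verified Lean document; each statement's English description precedes it below -/
import Mathlib

section
/- Let M be a right A-module with hermitian form h, and let ∇₊, ∇₋ : M → M be maps. Then the identity X₊(h(m₁,m₂)) = h(m₁,∇₊m₂) − K²(h(∇₋m₁,m₂)) holds for all m₁,m₂ ∈ M if and only if the identity X₋(h(m₁,m₂)) = h(m₁,∇₋m₂) − K²(h(∇₊m₁,m₂)) holds for all m₁,m₂ ∈ M. -/
open MulOpposite

/-- If `Y (star f) = -K² (star (X f))` and `h` is hermitian, then compatibility of `X` with the
maps `n, n'` gives compatibility of `Y` with the maps `n', n`. -/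
theorem metric_compatibility_conj
    {A M : Type*} [Ring A] [StarRing A] [Module ℂ A]
    (K : A ≃ₗ[ℂ] A) (hKstar : ∀ f : A, star (K f) = K.symm (star f))
    (X Y : A → A) (hYstar : ∀ f : A, Y (star f) = -(K (K (star (X f)))))
    (h : M → M → A) (hstar : ∀ m₁ m₂ : M, star (h m₁ m₂) = h m₂ m₁) (n n' : M → M)
    (hX : ∀ m₁ m₂ : M, X (h m₁ m₂) = h m₁ (n m₂) - K (K (h (n' m₁) m₂))) (m₁ m₂ : M) :
    Y (h m₁ m₂) = h m₁ (n' m₂) - K (K (h (n m₁) m₂)) := by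
  rw [← hstar m₂ m₁, hYstar, hX]
  simp [hKstar, hstar]

/-- For a right `A`-module `M` with hermitian form `h` and maps
`∇₊, ∇₋ : M → M`, the compatibility identity for `X₊` holds for all `m₁, m₂` if and
only if the compatibility identity for `X₋` holds for all `m₁, m₂`. -/
theorem metric_compatibility_p_iff_m
    {A : Type*} [Ring A] [StarRing A] [Algebra ℂ A] [StarModule ℂ A]
    (K : A ≃ₗ[ℂ] A) (hKstar : ∀ f : A, star (K f) = K.symm (star f))
    (Xp Xm : A →ₗ[ℂ] A)
    (hXpstar : ∀ f : A, Xp (star f) = -(K (K (star (Xm f)))))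
    (hXmstar : ∀ f : A, Xm (star f) = -(K (K (star (Xp f)))))
    {M : Type*} [AddCommGroup M] [Module Aᵐᵒᵖ M]
    (h : M → M → A)
    (hadd₁ : ∀ m₁ m₂ m₃ : M, h (m₁ + m₂) m₃ = h m₁ m₃ + h m₂ m₃)
    (hadd₂ : ∀ m₁ m₂ m₃ : M, h m₁ (m₂ + m₃) = h m₁ m₂ + h m₁ m₃)
    (hlin : ∀ (m₁ m₂ : M) (f : A), h m₁ (op f • m₂) = h m₁ m₂ * f)
    (hstar : ∀ m₁ m₂ : M, star (h m₁ m₂) = h m₂ m₁)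
    (np nm : M → M) :
    (∀ m₁ m₂ : M, Xp (h m₁ m₂) = h m₁ (np m₂) - K (K (h (nm m₁) m₂))) ↔
    (∀ m₁ m₂ : M, Xm (h m₁ m₂) = h m₁ (nm m₂) - K (K (h (np m₁) m₂))) :=
  ⟨metric_compatibility_conj K hKstar Xp Xm hXmstar h hstar np nm,
    metric_compatibility_conj K hKstar Xm Xp hXpstar h hstar nm np⟩
end

section
/- Let M = Aⁿ be the free right A-module with basis e₁,…,eₙ, let h be an invertible hermitian form on M with h_{ij} = h(e_i,e_j) and two-sided inverse matrix h^{ij} (so Σ_j h^{ij}h_{jk} = δ^i_k·1 = Σ_j h_{kj}h^{ji}), and let ∇₊, ∇₋, ∇_z be connections on M (twisted by K², K², K⁴ respectively) with Christoffel symbols ∇ₐ(e_i) = Σ_j e_j·Γ^j_{ai}. Then the triple (∇₊,∇₋,∇_z) is compatible with h, i.e. X₊(h(m₁,m₂)) = h(m₁,∇₊m₂) − K²(h(∇₋m₁,m₂)), X₋(h(m₁,m₂)) = h(m₁,∇₋m₂) − K²(h(∇₊m₁,m₂)) and X_z(h(m₁,m₂)) = h(m₁,∇_zm₂) − K⁴(h(∇_zm₁,m₂))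 for all m₁,m₂ ∈ M, if and only if there exist elements γ_{ij}, ρ_{ij} ∈ A with ρ_{ij}* = ρ_{ji} such that Γ^i_{+j} = Σ_k h^{ik}(½·X₊(h_{kj}) + K(γ_{kj})), Γ^i_{−j} = Σ_k h^{ik}(½·X₋(h_{kj}) + K(γ_{jk}*)), and Γ^i_{zj} = Σ_k h^{ik}(½·X_z(h_{kj}) + K²(ρ_{kj})). -/
open Finset

/-- Left multiplication by an invertible matrix turns `c = h⁻¹ b` into `h c = b`. -/
theorem eq_sum_inv_mul_iff {A : Type*} [Ring A] {n : ℕ} {h hinv : Fin n → Fin n → A}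
    (hinv1 : ∀ i k, (∑ j, hinv i j * h j k) = if i = k then 1 else 0)
    (hinv2 : ∀ i k, (∑ j, h k j * hinv j i) = if i = k then 1 else 0)
    (c b : Fin n → Fin n → A) :
    (∀ i j, c i j = ∑ k, hinv i k * b k j) ↔ ∀ i j, ∑ k, h i k * c k j = b i j := by
  have h1 : Matrix.of hinv * Matrix.of h = 1 := by
    ext i k
    simpa [Matrix.mul_apply, Matrix.one_apply] using hinv1 i k
  have h2 : Matrix.of h * Matrix.of hinv = 1 := by
    ext i k
    simpa [Matrix.mul_apply, Matrix.one_apply, eq_comm] using hinv2 k i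
  have key : Matrix.of c = Matrix.of hinv * Matrix.of b ↔
      Matrix.of h * Matrix.of c = Matrix.of b := by
    constructor <;> intro H
    · rw [H, ← mul_assoc, h2, one_mul]
    · rw [← H, ← mul_assoc, h1, one_mul]
  simpa [← Matrix.ext_iff, Matrix.mul_apply] using key

section TwistedConnections

variable {A : Type*} [Ring A] [Algebra ℂ A]

/-- A twisted connection on `Aⁿ` is determined by its Christoffel symbols. -/
theorem twisted_connection_apply {σ : A ≃ₐ[ℂ] A} {X : A →ₗ[ℂ] A} {n : ℕ}
    {P : (Fin n → A) →ₗ[ℂ] (Fin n → A)}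
    (hP : ∀ (m : Fin n → A) (f : A),
      P (fun i => m i * f) = (fun i => P m i * σ f) + (fun i => m i * X f))
    (m : Fin n → A) (i : Fin n) :
    P m i = ∑ j, P (Pi.single j 1) i * σ (m j) + X (m i) := by
  have hm : m = ∑ j, (fun i => (Pi.single j (1 : A) : Fin n → A) i * m j) := by
    ext i
    simp [Finset.sum_apply, Pi.single_apply]
  conv_lhs => rw [hm]
  rw [map_sum, Finset.sum_apply]
  simp only [hP, Pi.add_apply, Finset.sum_add_distrib]
  simp [Pi.single_apply]

variable [StarRing A] {σ : A ≃ₐ[ℂ] A} {X Y : A →ₗ[ℂ] A} {n : ℕ} {h : Fin n → Fin n → A}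
  {P Q : (Fin n → A) →ₗ[ℂ] (Fin n → A)}

/-- Compatibility of a pair of twisted connections with a hermitian form on `Aⁿ` can be
checked on the standard basis. -/
theorem twisted_compatible_iff_basis
    (hσ : ∀ f : A, star (σ f) = σ.symm (star f))
    (hX : ∀ f g : A, X (f * g) = f * X g + X f * σ g)
    (hXY : ∀ f : A, X (star f) = -σ (star (Y f)))
    (hsym : ∀ i j, star (h i j) = h j i)
    (hP : ∀ (m : Fin n → A) (f : A),
      P (fun i => m i * f) = (fun i => P m i * σ f) + (fun i => m i * X f))
    (hQ : ∀ (m : Fin n → A) (f : A),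
      Q (fun i => m i * f) = (fun i => Q m i * σ f) + (fun i => m i * Y f)) :
    (∀ m₁ m₂ : Fin n → A,
        X (∑ i, ∑ j, star (m₁ i) * h i j * m₂ j)
          = (∑ i, ∑ j, star (m₁ i) * h i j * P m₂ j)
            - σ (∑ i, ∑ j, star (Q m₁ i) * h i j * m₂ j)) ↔
      ∀ i j, X (h i j) = ∑ k, h i k * P (Pi.single j 1) k
        - σ (star (∑ k, h j k * Q (Pi.single i 1) k)) := by
  constructor
  · intro H i j
    have := H (Pi.single i 1) (Pi.single j 1)
    simpa [Pi.single_apply, apply_ite (star : A → A), ite_mul, mul_ite, hsym] using this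
  · intro H a b
    have e1 : ∀ i, ∑ j, h i j * P b j
        = ∑ j, ((∑ k, h i k * P (Pi.single j 1) k) * σ (b j) + h i j * X (b j)) := by
      intro i
      rw [Finset.sum_add_distrib]
      simp_rw [twisted_connection_apply hP b, mul_add, Finset.mul_sum, Finset.sum_add_distrib,
        Finset.sum_mul, mul_assoc]
      rw [Finset.sum_comm]
    have e2 : ∀ j, ∑ i, star (Q a i) * h i j
        = ∑ i, (σ.symm (star (a i)) * star (∑ k, h j k * Q (Pi.single i 1) k)
          + star (Y (a i)) * h i j) := by
      intro j
      rw [Finset.sum_add_distrib]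
      simp_rw [twisted_connection_apply hQ a, star_add, star_sum, star_mul, hσ, hsym, add_mul,
        Finset.mul_sum, Finset.sum_mul, Finset.sum_add_distrib, mul_assoc]
      rw [Finset.sum_comm]
    have t1 : ∑ i, ∑ j, star (a i) * h i j * P b j
        = ∑ i, ∑ j, star (a i) *
          ((∑ k, h i k * P (Pi.single j 1) k) * σ (b j) + h i j * X (b j)) := by
      simp_rw [mul_assoc, ← Finset.mul_sum, e1]
    have t2 : ∑ i, ∑ j, star (Q a i) * h i j * b j
        = ∑ i, ∑ j, (σ.symm (star (a i)) * star (∑ k, h j k * Q (Pi.single i 1) k)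
          + star (Y (a i)) * h i j) * b j := by
      rw [Finset.sum_comm]
      simp_rw [← Finset.sum_mul, e2]
      simp_rw [Finset.sum_mul]
      rw [Finset.sum_comm]
    rw [t1, t2]
    simp_rw [map_sum, ← Finset.sum_sub_distrib]
    refine Finset.sum_congr rfl fun i _ => Finset.sum_congr rfl fun j _ => ?_
    rw [hX, hX, hXY, H]
    simp only [map_mul, map_add, AlgEquiv.apply_symm_apply]
    noncomm_ring

end TwistedConnections

/-- On the free right `A`-module `Aⁿ` with invertible hermitian form given by
the matrix `(h_{ij})` (with two-sided inverse `(h^{ij})`), a triple of connections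
`(∇₊, ∇₋, ∇_z)` (twisted by `K², K², K⁴`) with Christoffel symbols
`∇ₐ(e_i) = Σ_j e_j·Γ^j_{ai}` is compatible with `h` if and only if there exist
`γ_{ij}, ρ_{ij}` with `ρ_{ij}* = ρ_{ji}` realizing the displayed formulas for the
Christoffel symbols. -/
theorem metric_connections_parametrization
    {A : Type*} [Ring A] [StarRing A] [Algebra ℂ A] [StarModule ℂ A]
    (K : A ≃ₐ[ℂ] A) (hKstar : ∀ f : A, star (K f) = K.symm (star f))
    (Xp Xm Xz : A →ₗ[ℂ] A)
    (hXpLeib : ∀ f g : A, Xp (f * g) = f * Xp g + Xp f * K (K g))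
    (hXmLeib : ∀ f g : A, Xm (f * g) = f * Xm g + Xm f * K (K g))
    (hXzLeib : ∀ f g : A, Xz (f * g) = f * Xz g + Xz f * K (K (K (K g))))
    (hXpstar : ∀ f : A, Xp (star f) = -(K (K (star (Xm f)))))
    (hXmstar : ∀ f : A, Xm (star f) = -(K (K (star (Xp f)))))
    (hXzstar : ∀ f : A, Xz (star f) = -(K (K (K (K (star (Xz f)))))))
    (n : ℕ) (hm hminv : Fin n → Fin n → A)
    (hsym : ∀ i j, star (hm i j) = hm j i)
    (hinv1 : ∀ i k, (∑ j, hminv i j * hm j k) = if i = k then 1 else 0)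
    (hinv2 : ∀ i k, (∑ j, hm k j * hminv j i) = if i = k then 1 else 0)
    (np nm nz : (Fin n → A) →ₗ[ℂ] (Fin n → A))
    (hnpConn : ∀ (m : Fin n → A) (f : A),
      np (fun i => m i * f) = (fun i => np m i * K (K f)) + (fun i => m i * Xp f))
    (hnmConn : ∀ (m : Fin n → A) (f : A),
      nm (fun i => m i * f) = (fun i => nm m i * K (K f)) + (fun i => m i * Xm f))
    (hnzConn : ∀ (m : Fin n → A) (f : A),
      nz (fun i => m i * f) = (fun i => nz m i * K (K (K (K f)))) + (fun i => m i * Xz f)) :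
    -- compatibility with h
    ((∀ m₁ m₂ : Fin n → A,
        Xp (∑ i, ∑ j, star (m₁ i) * hm i j * m₂ j)
          = (∑ i, ∑ j, star (m₁ i) * hm i j * np m₂ j)
            - K (K (∑ i, ∑ j, star (nm m₁ i) * hm i j * m₂ j))) ∧
      (∀ m₁ m₂ : Fin n → A,
        Xm (∑ i, ∑ j, star (m₁ i) * hm i j * m₂ j)
          = (∑ i, ∑ j, star (m₁ i) * hm i j * nm m₂ j)
            - K (K (∑ i, ∑ j, star (np m₁ i) * hm i j * m₂ j))) ∧
      (∀ m₁ m₂ : Fin n → A,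
        Xz (∑ i, ∑ j, star (m₁ i) * hm i j * m₂ j)
          = (∑ i, ∑ j, star (m₁ i) * hm i j * nz m₂ j)
            - K (K (K (K (∑ i, ∑ j, star (nz m₁ i) * hm i j * m₂ j))))))
    ↔
    -- parametrization of the Christoffel symbols
    (∃ γ ρ : Fin n → Fin n → A,
      (∀ i j, star (ρ i j) = ρ j i) ∧
      (∀ i j, np (Pi.single j 1) i
          = ∑ k, hminv i k * ((2⁻¹ : ℂ) • Xp (hm k j) + K (γ k j))) ∧
      (∀ i j, nm (Pi.single j 1) i
          = ∑ k, hminv i k * ((2⁻¹ : ℂ) • Xm (hm k j) + K (star (γ j k)))) ∧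
      (∀ i j, nz (Pi.single j 1) i
          = ∑ k, hminv i k * ((2⁻¹ : ℂ) • Xz (hm k j) + K (K (ρ k j))))) := by
  have hKs : ∀ f, star (K.symm f) = K (star f) := fun f => by
    rw [← K.apply_symm_apply (star (K.symm f)), ← hKstar, K.apply_symm_apply]
  have half : ∀ x : A, (2⁻¹ : ℂ) • x + (2⁻¹ : ℂ) • x = x := fun x => by
    rw [← add_smul]; norm_num
  have hstar2 : star (2⁻¹ : ℂ) = 2⁻¹ := by simp
  have h2 : ∀ f, star ((K.trans K) f) = (K.trans K).symm (star f) := fun f => by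
    simp [hKstar]
  have h4 : ∀ f, star (((K.trans K).trans (K.trans K)) f)
      = ((K.trans K).trans (K.trans K)).symm (star f) := fun f => by
    simp [hKstar]
  have cp := twisted_compatible_iff_basis h2 hXpLeib hXpstar hsym hnpConn hnmConn
  have cm := twisted_compatible_iff_basis h2 hXmLeib hXmstar hsym hnmConn hnpConn
  have cz := twisted_compatible_iff_basis h4 hXzLeib hXzstar hsym hnzConn hnzConn
  simp only [AlgEquiv.trans_apply] at cp cm cz
  rw [cp, cm, cz]
  have gp := fun γ : Fin n → Fin n → A => eq_sum_inv_mul_iff hinv1 hinv2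
    (fun i j => np (Pi.single j 1) i) (fun k j => (2⁻¹ : ℂ) • Xp (hm k j) + K (γ k j))
  have gm := fun γ : Fin n → Fin n → A => eq_sum_inv_mul_iff hinv1 hinv2
    (fun i j => nm (Pi.single j 1) i) (fun k j => (2⁻¹ : ℂ) • Xm (hm k j) + K (star (γ j k)))
  have gz := fun ρ : Fin n → Fin n → A => eq_sum_inv_mul_iff hinv1 hinv2
    (fun i j => nz (Pi.single j 1) i) (fun k j => (2⁻¹ : ℂ) • Xz (hm k j) + K (K (ρ k j)))
  simp only [gp, gm, gz]
  generalize hGp : (fun i j => ∑ k, hm i k * np (Pi.single j 1) k) = Gp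
  generalize hGm : (fun i j => ∑ k, hm i k * nm (Pi.single j 1) k) = Gm
  generalize hGz : (fun i j => ∑ k, hm i k * nz (Pi.single j 1) k) = Gz
  simp only [funext_iff] at hGp hGm hGz
  simp only [hGp, hGm, hGz]
  have sp : ∀ i j, K (K (star (Xp (hm i j)))) = -Xm (hm j i) := fun i j => by
    rw [← hsym i j, hXmstar, neg_neg]
  have sm : ∀ i j, K (K (star (Xm (hm i j)))) = -Xp (hm j i) := fun i j => by
    rw [← hsym i j, hXpstar, neg_neg]
  have sz : ∀ i j, K (K (K (K (star (Xz (hm i j)))))) = -Xz (hm j i) := fun i j => by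
    rw [← hsym i j, hXzstar, neg_neg]
  constructor
  · rintro ⟨-, Hm, Hz⟩
    refine ⟨fun i j => K.symm (Gp i j - (2⁻¹ : ℂ) • Xp (hm i j)),
      fun i j => K.symm (K.symm (Gz i j - (2⁻¹ : ℂ) • Xz (hm i j))), ?_, ?_, ?_, ?_⟩
    · intro i j
      apply K.injective
      apply K.injective
      have e : Gz j i = Xz (hm j i) + K (K (K (K (star (Gz i j))))) := by rw [Hz j i]; abel
      simp only [hKs, AlgEquiv.apply_symm_apply, star_sub, star_smul, map_sub, map_smul, hstar2,
        sz, e, smul_neg]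
      nth_rewrite 2 [← half (Xz (hm j i))]
      abel
    · intro i j
      simp
    · intro i j
      have e : Gm i j = Xm (hm i j) + K (K (star (Gp j i))) := by rw [Hm i j]; abel
      simp only [hKs, star_sub, star_smul, map_sub, map_smul, hstar2, sp, e, smul_neg]
      nth_rewrite 1 [← half (Xm (hm i j))]
      abel
    · intro i j
      simp
  · rintro ⟨γ, ρ, hρ, Hp, Hm, Hz⟩
    refine ⟨fun i j => ?_, fun i j => ?_, fun i j => ?_⟩
    · simp only [Hp, Hm, star_add, star_smul, map_add, map_smul, hstar2, sm, hKstar, star_star,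
        AlgEquiv.apply_symm_apply, smul_neg]
      nth_rewrite 1 [← half (Xp (hm i j))]
      abel
    · simp only [Hp, Hm, star_add, star_smul, map_add, map_smul, hstar2, sp, hKstar,
        AlgEquiv.apply_symm_apply, smul_neg]
      nth_rewrite 1 [← half (Xm (hm i j))]
      abel
    · simp only [Hz, star_add, star_smul, map_add, map_smul, hstar2, sz, hKstar, hρ,
        AlgEquiv.apply_symm_apply, smul_neg]
      nth_rewrite 1 [← half (Xz (hm i j))]
      abel
end

section
/- Let Ω be the free right A-module with basis ω₊, ω₋, ω_z, and let h be an invertible hermitian form on Ω with h_{ab} = h(ω_a,ω_b) (a,b ∈ {+,−,z}) and two-sided inverse matrix h^{ab}. Then there exists a triple (∇₊,∇₋,∇_z) of connections on Ω (i.e. ∇₊, ∇₋ are (X₊,K²)-, (X₋,K²)-connections and ∇_z is an (X_z,K⁴)-connection) which is compatible with h — meaning X₊(h(m₁,m₂)) = h(m₁,∇₊m₂) − K²(h(∇₋m₁,m₂)), X₋(h(m₁,m₂)) = h(m₁,∇₋m₂) − K²(h(∇₊m₁,m₂)), X_z(h(m₁,m₂)) = h(m₁,∇_zm₂) − K⁴(h(∇_zm₁,m₂))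 for all m₁,m₂ ∈ Ω — and torsion free — meaning ∇₋ω₊ − q²·∇₊ω₋ = ω_z, q²·∇_zω₋ − q⁻²·∇₋ω_z = (1+q²)·ω₋, and q²·∇₊ω_z − q⁻²·∇_zω₊ = (1+q²)·ω₊ — if and only if X_z(h_{++} − q²h_{−−}) = K²(X₋(h_{z+})) − q²·X₋(h_{−z}) − q²·K²(X₊(h_{z−})) + X₊(h_{+z}). -/
open Finset

theorem matrix_mul_cancel_left {A ι : Type*} [Ring A] [Fintype ι] [DecidableEq ι]
    (u v : ι → ι → A)
    (huv : ∀ a b, (∑ c, u b c * v c a) = if a = b then 1 else 0) (N : ι → ι → A) (a b : ι) :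
    ∑ c, u a c * ∑ d, v c d * N d b = N a b := by
  simp_rw [Finset.mul_sum, ← mul_assoc]
  rw [Finset.sum_comm]
  simp_rw [← Finset.sum_mul, huv]
  simp

theorem eq_of_pairing_eq {A ι : Type*} [Ring A] [Fintype ι] [DecidableEq ι]
    (u v : ι → ι → A)
    (hvu : ∀ a b, (∑ c, v a c * u c b) = if a = b then 1 else 0) {m n : ι → A}
    (hmn : ∀ a, ∑ c, u a c * m c = ∑ c, u a c * n c) : m = n := by
  have hvu' : ∀ a b, (∑ c, v b c * u c a) = if a = b then 1 else 0 := fun a b => by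
    rw [hvu]; simp [eq_comm]
  ext i
  rw [← matrix_mul_cancel_left v u hvu' (fun c _ => m c) i i,
    ← matrix_mul_cancel_left v u hvu' (fun c _ => n c) i i]
  simp_rw [hmn]

section TwistedConnections

variable {A : Type*} [Ring A] [Algebra ℂ A] {ι : Type*} [Fintype ι]

/-- The connection on the free right module `ι → A` twisted by `σ`, with underlying twisted
derivation `X` and Christoffel symbols `G`. -/
def christoffelConnection (σ : A →ₐ[ℂ] A) (X : A →ₗ[ℂ] A) (G : ι → ι → A) :
    (ι → A) →ₗ[ℂ] (ι → A) where
  toFun m i := ∑ b, G i b * σ (m b) + X (m i)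
  map_add' m n := by
    ext i
    simp only [Pi.add_apply, map_add, mul_add, Finset.sum_add_distrib]
    abel
  map_smul' c m := by
    ext i
    simp [Finset.smul_sum]

theorem christoffelConnection_apply (σ : A →ₐ[ℂ] A) (X : A →ₗ[ℂ] A) (G : ι → ι → A)
    (m : ι → A) (i : ι) :
    christoffelConnection σ X G m i = ∑ b, G i b * σ (m b) + X (m i) := rfl

theorem christoffelConnection_mul (σ : A →ₐ[ℂ] A) (X : A →ₗ[ℂ] A)
    (hX : ∀ f g, X (f * g) = f * X g + X f * σ g) (G : ι → ι → A) (m : ι → A) (f : A) :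
    christoffelConnection σ X G (fun i => m i * f)
      = (fun i => christoffelConnection σ X G m i * σ f) + (fun i => m i * X f) := by
  ext i
  simp only [christoffelConnection_apply, Pi.add_apply, map_mul, hX, add_mul, Finset.sum_mul,
    mul_assoc]
  abel

theorem twistedDerivation_one (σ : A →ₐ[ℂ] A) (X : A →ₗ[ℂ] A)
    (hX : ∀ f g, X (f * g) = f * X g + X f * σ g) : X 1 = 0 := by
  simpa using hX 1 1

theorem christoffelConnection_single [DecidableEq ι] (σ : A →ₐ[ℂ] A) (X : A →ₗ[ℂ] A)
    (hX : ∀ f g, X (f * g) = f * X g + X f * σ g) (G : ι → ι → A) (b : ι) :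
    christoffelConnection σ X G (Pi.single b 1) = fun i => G i b := by
  have h1 := twistedDerivation_one σ X hX
  ext i
  rw [christoffelConnection_apply, Finset.sum_eq_single b]
  · rcases eq_or_ne i b with rfl | h <;> simp_all
  · intro c _ hc
    simp [hc]
  · simp

variable [StarRing A]

theorem christoffelConnection_compatible (σ : A →ₐ[ℂ] A) (X X' : A →ₗ[ℂ] A)
    (hσ : ∀ f, σ (star (σ f)) = star f)
    (hX : ∀ f g, X (f * g) = f * X g + X f * σ g)
    (hXstar : ∀ f, X (star f) = -σ (star (X' f)))
    (h : ι → ι → A) (hsym : ∀ a b, star (h a b) = h b a) (G G' : ι → ι → A)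
    (hG : ∀ a b, X (h a b) = (∑ c, h a c * G c b) - σ (star (∑ c, h b c * G' c a)))
    (m n : ι → A) :
    X (∑ a, ∑ b, star (m a) * h a b * n b)
      = (∑ a, ∑ b, star (m a) * h a b * christoffelConnection σ X G n b)
        - σ (∑ a, ∑ b, star (christoffelConnection σ X' G' m a) * h a b * n b) := by
  have e1 : ∑ a, ∑ b, star (m a) * h a b * christoffelConnection σ X G n b
      = (∑ a, ∑ b, star (m a) * (∑ c, h a c * G c b) * σ (n b))
        + ∑ a, ∑ b, star (m a) * h a b * X (n b) := by
    simp only [christoffelConnection_apply, mul_add, Finset.sum_add_distrib, Finset.mul_sum,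
      Finset.sum_mul, mul_assoc]
    congr 1
    exact Finset.sum_congr rfl fun a _ => Finset.sum_comm
  have e2 : σ (∑ a, ∑ b, star (christoffelConnection σ X' G' m a) * h a b * n b)
      = (∑ a, ∑ b, star (m a) * σ (star (∑ c, h b c * G' c a)) * σ (n b))
        - ∑ a, ∑ b, X (star (m a)) * σ (h a b) * σ (n b) := by
    simp only [christoffelConnection_apply, star_add, star_sum, star_mul, add_mul, map_add, map_sum,
      map_mul, Finset.sum_add_distrib, hσ, hsym, hXstar, neg_mul, Finset.sum_neg_distrib,
      Finset.mul_sum, Finset.sum_mul, mul_assoc, sub_neg_eq_add]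
    congr 1
    rw [Finset.sum_congr rfl fun a _ => Finset.sum_comm, Finset.sum_comm]
    exact Finset.sum_congr rfl fun a _ => Finset.sum_comm
  rw [e1, e2]
  simp only [map_sum, hX, hG, mul_sub, sub_mul, mul_add, map_mul, Finset.sum_add_distrib,
    Finset.sum_sub_distrib, mul_assoc]
  abel

theorem compatible_on_basis [DecidableEq ι] (σ : A →ₐ[ℂ] A) (X : A →ₗ[ℂ] A)
    (h : ι → ι → A) (hsym : ∀ a b, star (h a b) = h b a) (D D' : (ι → A) →ₗ[ℂ] (ι → A))
    (hD : ∀ m n : ι → A, X (∑ a, ∑ b, star (m a) * h a b * n b)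
      = (∑ a, ∑ b, star (m a) * h a b * D n b)
        - σ (∑ a, ∑ b, star (D' m a) * h a b * n b)) (a b : ι) :
    X (h a b) = (∑ c, h a c * D (Pi.single b 1) c)
      - σ (star (∑ c, h b c * D' (Pi.single a 1) c)) := by
  have := hD (Pi.single a 1) (Pi.single b 1)
  simpa [apply_ite star, Pi.single_apply, hsym, ite_mul] using this

end TwistedConnections

section MatrixEquations

variable {A : Type*} [Ring A] [StarRing A] [Algebra ℂ A] [StarModule ℂ A]

/-- The matrix form of the existence criterion: `P`, `M`, `Z` collect the pairings
`h(ω_a, ∇₊ω_b)`, `h(ω_a, ∇₋ω_b)`, `h(ω_a, ∇_zω_b)`. -/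
theorem pairing_matrices_exist_iff (Q : ℂ) (hQ0 : Q ≠ 0) (hQ1 : Q ≠ 1) (hQ : star Q = Q)
    (K : A ≃ₐ[ℂ] A) (hK : ∀ f : A, star (K f) = K.symm (star f))
    (Xp Xm Xz : A →ₗ[ℂ] A)
    (hXpstar : ∀ f : A, Xp (star f) = -(K (K (star (Xm f)))))
    (hXz : ∀ f : A, Xz f = (1 - Q⁻¹)⁻¹ • (f - K (K (K (K f)))))
    (h : Fin 3 → Fin 3 → A) (hsym : ∀ a b, star (h a b) = h b a) :
    (∃ P M Z : Fin 3 → Fin 3 → A,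
      (∀ a b, Xp (h a b) = P a b - K (K (star (M b a)))) ∧
      (∀ a b, Xm (h a b) = M a b - K (K (star (P b a)))) ∧
      (∀ a b, Xz (h a b) = Z a b - K (K (K (K (star (Z b a)))))) ∧
      (∀ a, M a 0 - Q • P a 1 = h a 2) ∧
      (∀ a, Q • Z a 1 - Q⁻¹ • M a 2 = (1 + Q) • h a 1) ∧
      (∀ a, Q • P a 2 - Q⁻¹ • Z a 0 = (1 + Q) • h a 0))
    ↔ Xz (h 0 0 - Q • h 1 1)
      = K (K (Xm (h 2 0))) - Q • Xm (h 1 2) - Q • K (K (Xp (h 2 1))) + Xp (h 0 2) := by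
  have hQ1' : Q - 1 ≠ 0 := sub_ne_zero.2 hQ1
  have hc : (1 - Q⁻¹ : ℂ)⁻¹ = Q / (Q - 1) := by
    have : 1 - Q⁻¹ ≠ 0 := by
      intro h0
      apply hQ1
      field_simp at h0
      linear_combination h0
    field_simp
  have hXp : ∀ a b, Xp (h a b) = -(K (K (star (Xm (h b a))))) := fun a b => by
    rw [← hXpstar, hsym]
  have hQi : star Q⁻¹ = Q⁻¹ := by rw [star_inv₀, hQ]
  have hcs : star (Q / (Q - 1)) = Q / (Q - 1) := by simp [star_div₀, hQ]
  rw [hXp 2 1, hXp 0 2]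
  constructor
  · rintro ⟨P, M, Z, -, hM, hZ, t1, t2, t3⟩
    have k1 := congrArg (fun f => K (K f)) (t1 2)
    have s1 := congrArg (fun f => K (K (star f))) (t1 2)
    have s2 := congrArg (fun f => K (K (K (K (star f))))) (t2 1)
    have s3 := congrArg (fun f => K (K (K (K (star f))))) (t3 0)
    have z0 := hZ 0 0
    have z1 := hZ 1 1
    have t2 := t2 1
    have t3 := t3 0
    rw [hXz, hc] at z0 z1
    rw [hM 2 0, hM 1 2, hXz, hc]
    simp only [map_sub, map_smul, map_neg, star_sub, star_smul, star_add, star_one, hQ, hQi, hK,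
      AlgEquiv.apply_symm_apply, star_star, hsym] at k1 s1 s2 s3 t2 t3 z0 z1 ⊢
    linear_combination (norm := skip) (Q⁻¹ ^ 2) • z0 - (Q ^ 3) • z1 - (Q ^ 2) • t2 + (Q ^ 2) • s2
      - Q⁻¹ • t3 + Q⁻¹ • s3 - k1 + s1
    match_scalars <;> field_simp <;> ring
  · intro hcond
    obtain ⟨φ, hφ⟩ : ∃ φ : A → A, ∀ f, φ f = K (K (K (K (star f)))) := ⟨_, fun _ => rfl⟩
    obtain ⟨ψ, hψ⟩ : ∃ ψ : A → A, ∀ f, ψ f = K (K (star f)) := ⟨_, fun _ => rfl⟩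
    have hψψ : ∀ f, ψ (ψ f) = f := fun f => by simp [hψ, hK]
    let c : ℂ := Q / (Q - 1)
    let p := c • h 0 0
    let p01 := Q⁻¹ • (Xm (h 0 0) - h 0 2)
    let p11 := Q⁻¹ • (Xm (h 1 0) + ψ p01 - h 1 2)
    let s := Q⁻¹ • (Xm (h 2 0) + ψ p - h 2 2)
    let z00 := Q • (Q • p - (1 + Q) • h 0 0)
    let z10 := -((Q * (1 + Q)) • h 1 0)
    let z20 := -((Q * (1 + Q)) • h 2 0)
    let z21 := Q⁻¹ • ((1 + Q) • h 2 1 + Q⁻¹ • Xm (h 2 2))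
    let z11 := Q⁻¹ • ((1 + Q) • h 1 1 + Q⁻¹ • (Xm (h 1 2) + ψ s))
    let z01 := Xz (h 0 1) + φ z10
    let m02 := Q • (Q • z01 - (1 + Q) • h 0 1)
    let P : Fin 3 → Fin 3 → A :=
      ![![0, p01, p], ![0, p11, 0], ![ψ (m02 - Xm (h 0 2)), s, 0]]
    let Z : Fin 3 → Fin 3 → A :=
      ![![z00, z01, Xz (h 0 2) + φ z20], ![z10, z11, Xz (h 1 2) + φ z21],
        ![z20, z21, c • h 2 2]]
    have hψ0 : ψ 0 = 0 := by simp [hψ]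
    have hcf : ∀ a b, Xz (h a b) = c • h a b - φ (c • h b a) := fun a b => by
      rw [hXz, hc, hφ]
      simp only [star_smul, hcs, hsym, map_smul, c, smul_sub]
    have hoff : ∀ a b z, Xz (h a b) = z - φ (Xz (h b a) + φ z) := fun a b z => by
      rw [hcf a b, hcf b a]
      simp only [hφ, map_add, map_sub, map_smul, star_add, star_sub, star_smul, hK,
        AlgEquiv.apply_symm_apply, star_star, hsym, c, hcs]
      abel
    have h00 : Xz (h 0 0) = z00 - φ z00 := by
      simp only [hXz, hc, z00, p, c, hφ, map_sub, map_smul, star_sub, star_smul, star_add,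
        star_one, hQ, hcs, hsym]
      match_scalars <;> field_simp <;> ring
    have h11 : Xz (h 1 1) = z11 - φ z11 := by
      simp only [hXz, hc, z11, s, p, c, hφ, hψ, map_sub, map_add, map_neg, map_smul, star_sub,
        star_smul, star_add, star_one, hQ, hQi, hcs, hsym, hK, AlgEquiv.apply_symm_apply,
        star_star] at hcond ⊢
      linear_combination (norm := skip) (-(Q⁻¹ ^ 3)) • hcond
      match_scalars <;> field_simp <;> ring
    have hZ : ∀ a b, Xz (h a b) = Z a b - φ (Z b a) := by
      intro a b
      fin_cases a <;> fin_cases b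
      · exact h00
      · simp [Z, z01]
      · simp [Z]
      · exact hoff 1 0 z10
      · exact h11
      · simp [Z]
      · exact hoff 2 0 z20
      · exact hoff 2 1 z21
      · exact hcf 2 2
    refine ⟨P, fun a b => Xm (h a b) + ψ (P b a), Z, fun a b => ?_, fun a b => ?_, fun a b => ?_,
      fun a => ?_, fun a => ?_, fun a => ?_⟩
    · rw [hXp]
      simp [hψ, hK]
    · simp [hψ]
    · rw [← hφ]
      exact hZ a b
    · fin_cases a <;> simp [P, hψ0, p01, p11, s, smul_smul, hQ0]
    · fin_cases a <;> simp [P, Z, hψ0, hψψ, z11, z21, m02, smul_smul, hQ0]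
    · fin_cases a <;> simp [P, Z, z00, z10, z20, smul_smul, hQ0]

end MatrixEquations

/-- On the free right `A`-module `Ω` with basis `ω₊, ω₋, ω_z` (encoded as
`Fin 3 → A` with `ω₊ = e₀`, `ω₋ = e₁`, `ω_z = e₂`) with invertible hermitian form given
by the matrix `(h_{ab})`, there exists a triple `(∇₊, ∇₋, ∇_z)` of connections which is
compatible with `h` and torsion free if and only if
`X_z(h₊₊ − q²h₋₋) = K²(X₋(h_{z+})) − q²X₋(h_{−z}) − q²K²(X₊(h_{z−})) + X₊(h_{+z})`. -/
theorem levi_civita_existence_iff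
    {A : Type*} [Ring A] [StarRing A] [Algebra ℂ A] [StarModule ℂ A]
    (q : ℝ) (hq0 : q ≠ 0) (hq1 : q ≠ 1) (hqm1 : q ≠ -1)
    (K : A ≃ₐ[ℂ] A) (hKstar : ∀ f : A, star (K f) = K.symm (star f))
    (Xp Xm : A →ₗ[ℂ] A)
    (hXpLeib : ∀ f g : A, Xp (f * g) = f * Xp g + Xp f * K (K g))
    (hXmLeib : ∀ f g : A, Xm (f * g) = f * Xm g + Xm f * K (K g))
    (hXpstar : ∀ f : A, Xp (star f) = -(K (K (star (Xm f)))))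
    (hXmstar : ∀ f : A, Xm (star f) = -(K (K (star (Xp f)))))
    (Xz : A →ₗ[ℂ] A)
    (hXz : ∀ f : A, Xz f = ((1 : ℂ) - ((q : ℂ))⁻¹ ^ 2)⁻¹ • (f - K (K (K (K f)))))
    (hm hminv : Fin 3 → Fin 3 → A)
    (hsym : ∀ a b, star (hm a b) = hm b a)
    (hinv1 : ∀ a b, (∑ c, hminv a c * hm c b) = if a = b then 1 else 0)
    (hinv2 : ∀ a b, (∑ c, hm b c * hminv c a) = if a = b then 1 else 0) :
    (∃ np nm nz : (Fin 3 → A) →ₗ[ℂ] (Fin 3 → A),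
      -- (X₊,K²)-, (X₋,K²)-, (X_z,K⁴)-connections
      (∀ (m : Fin 3 → A) (f : A),
        np (fun i => m i * f) = (fun i => np m i * K (K f)) + (fun i => m i * Xp f)) ∧
      (∀ (m : Fin 3 → A) (f : A),
        nm (fun i => m i * f) = (fun i => nm m i * K (K f)) + (fun i => m i * Xm f)) ∧
      (∀ (m : Fin 3 → A) (f : A),
        nz (fun i => m i * f) = (fun i => nz m i * K (K (K (K f)))) + (fun i => m i * Xz f)) ∧
      -- compatibility with the hermitian form h
      (∀ m₁ m₂ : Fin 3 → A,
        Xp (∑ a, ∑ b, star (m₁ a) * hm a b * m₂ b)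
          = (∑ a, ∑ b, star (m₁ a) * hm a b * np m₂ b)
            - K (K (∑ a, ∑ b, star (nm m₁ a) * hm a b * m₂ b))) ∧
      (∀ m₁ m₂ : Fin 3 → A,
        Xm (∑ a, ∑ b, star (m₁ a) * hm a b * m₂ b)
          = (∑ a, ∑ b, star (m₁ a) * hm a b * nm m₂ b)
            - K (K (∑ a, ∑ b, star (np m₁ a) * hm a b * m₂ b))) ∧
      (∀ m₁ m₂ : Fin 3 → A,
        Xz (∑ a, ∑ b, star (m₁ a) * hm a b * m₂ b)
          = (∑ a, ∑ b, star (m₁ a) * hm a b * nz m₂ b)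
            - K (K (K (K (∑ a, ∑ b, star (nz m₁ a) * hm a b * m₂ b))))) ∧
      -- torsion freeness
      nm (Pi.single 0 1) - (q : ℂ) ^ 2 • np (Pi.single 1 1) = Pi.single 2 1 ∧
      (q : ℂ) ^ 2 • nz (Pi.single 1 1) - ((q : ℂ))⁻¹ ^ 2 • nm (Pi.single 2 1)
        = (1 + (q : ℂ) ^ 2) • (Pi.single 1 1 : Fin 3 → A) ∧
      (q : ℂ) ^ 2 • np (Pi.single 2 1) - ((q : ℂ))⁻¹ ^ 2 • nz (Pi.single 0 1)
        = (1 + (q : ℂ) ^ 2) • (Pi.single 0 1 : Fin 3 → A))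
    ↔
    Xz (hm 0 0 - (q : ℂ) ^ 2 • hm 1 1)
      = K (K (Xm (hm 2 0))) - (q : ℂ) ^ 2 • Xm (hm 1 2)
        - (q : ℂ) ^ 2 • K (K (Xp (hm 2 1))) + Xp (hm 0 2) := by
  have hK2 : ∀ f, K (K (star (K (K f)))) = star f := fun f => by simp [hKstar]
  have hQ : star ((q : ℂ) ^ 2) = (q : ℂ) ^ 2 := by simp
  have hQ0 : (q : ℂ) ^ 2 ≠ 0 := by simpa using hq0
  have hQ1 : (q : ℂ) ^ 2 ≠ 1 := fun h => by
    have h' : q ^ 2 = 1 := by exact_mod_cast h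
    rcases mul_self_eq_one_iff.1 ((pow_two q).symm.trans h') with h | h
    exacts [hq1 h, hqm1 h]
  simp only [inv_pow] at hXz ⊢
  have hXzLeib : ∀ f g : A, Xz (f * g) = f * Xz g + Xz f * K (K (K (K g))) := fun f g => by
    simp only [hXz, map_mul, mul_smul_comm, smul_mul_assoc, ← smul_add, mul_sub, sub_mul]
    congr 1
    abel
  have hXzstar : ∀ f : A, Xz (star f) = -(K (K (K (K (star (Xz f)))))) := fun f => by
    have hc : star ((1 - ((q : ℂ) ^ 2)⁻¹)⁻¹) = (1 - ((q : ℂ) ^ 2)⁻¹)⁻¹ := by simp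
    simp only [hXz, star_smul, hc, map_smul, star_sub, map_sub, hKstar,
      AlgEquiv.apply_symm_apply, ← smul_neg, neg_sub]
  rw [← pairing_matrices_exist_iff _ hQ0 hQ1 hQ K hKstar Xp Xm Xz hXpstar hXz hm hsym]
  let σ : A →ₐ[ℂ] A := (K : A →ₐ[ℂ] A).comp K
  let τ : A →ₐ[ℂ] A := σ.comp σ
  have hτ : ∀ f, τ (star (τ f)) = star f := fun f => by simp [τ, σ, hKstar]
  have hpair : ∀ (N : Fin 3 → Fin 3 → A) (a b : Fin 3),
      ∑ c, hm a c * ∑ d, hminv c d * N d b = N a b :=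
    matrix_mul_cancel_left hm hminv hinv2
  constructor
  · rintro ⟨np, nm, nz, -, -, -, hp, hm', hz, t1, t2, t3⟩
    let N : ((Fin 3 → A) →ₗ[ℂ] (Fin 3 → A)) → Fin 3 → Fin 3 → A :=
      fun D a b => ∑ c, hm a c * D (Pi.single b 1) c
    refine ⟨N np, N nm, N nz, compatible_on_basis σ Xp hm hsym np nm hp,
      compatible_on_basis σ Xm hm hsym nm np hm', compatible_on_basis τ Xz hm hsym nz nz hz,
      fun a => ?_, fun a => ?_, fun a => ?_⟩
    · have := congrArg (fun v : Fin 3 → A => ∑ c, hm a c * v c) t1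
      simpa [mul_sub, Finset.sum_sub_distrib, ← Finset.smul_sum, Pi.single_apply, N] using this
    · have := congrArg (fun v : Fin 3 → A => ∑ c, hm a c * v c) t2
      simpa [mul_sub, Finset.sum_sub_distrib, ← Finset.smul_sum, Pi.single_apply, N] using this
    · have := congrArg (fun v : Fin 3 → A => ∑ c, hm a c * v c) t3
      simpa [mul_sub, Finset.sum_sub_distrib, ← Finset.smul_sum, Pi.single_apply, N] using this
  · rintro ⟨P, M, Z, hP, hM, hZ, t1, t2, t3⟩
    let G : (Fin 3 → Fin 3 → A) → Fin 3 → Fin 3 → A := fun N a b => ∑ c, hminv a c * N c b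
    have hG : ∀ N a b, ∑ c, hm a c * G N c b = N a b := hpair
    refine ⟨christoffelConnection σ Xp (G P), christoffelConnection σ Xm (G M),
      christoffelConnection τ Xz (G Z), christoffelConnection_mul σ Xp hXpLeib (G P),
      christoffelConnection_mul σ Xm hXmLeib (G M), christoffelConnection_mul τ Xz hXzLeib (G Z),
      christoffelConnection_compatible σ Xp Xm hK2 hXpLeib hXpstar hm hsym _ _ fun a b => ?_,
      christoffelConnection_compatible σ Xm Xp hK2 hXmLeib hXmstar hm hsym _ _ fun a b => ?_,
      christoffelConnection_compatible τ Xz Xz hτ hXzLeib hXzstar hm hsym _ _ fun a b => ?_,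
      ?_, ?_, ?_⟩
    · rw [hG, hG]
      exact hP a b
    · rw [hG, hG]
      exact hM a b
    · rw [hG, hG]
      exact hZ a b
    all_goals
      refine eq_of_pairing_eq hm hminv hinv1 fun a => ?_
      simp only [christoffelConnection_single σ Xp hXpLeib,
        christoffelConnection_single σ Xm hXmLeib, christoffelConnection_single τ Xz hXzLeib,
        Pi.sub_apply, Pi.smul_apply, mul_sub, Finset.sum_sub_distrib, mul_smul_comm,
        ← Finset.smul_sum, hG, Pi.single_apply, mul_ite, mul_one, mul_zero, Finset.sum_ite_eq',
        Finset.mem_univ, if_true]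
      solve_by_elim
end

section
/- Let Ω be the free right A-module with basis ω₊, ω₋, ω_z, and let h be the diagonal hermitian form on Ω determined by h(ω₋,ω₋) = h, h(ω₊,ω₊) = q²·h, h(ω_z,ω_z) = h_z and h(ω_a,ω_b) = 0 for a ≠ b, where h, h_z ∈ A are invertible self-adjoint elements (h* = h, h_z* = h_z). Then there exists a triple (∇₊,∇₋,∇_z) of connections on Ω (∇₊, ∇₋ being (X₊,K²)-, (X₋,K²)-connections and ∇_z an (X_z,K⁴)-connection) which is compatible with h — meaning X₊(h(m₁,m₂)) = h(m₁,∇₊m₂) − K²(h(∇₋m₁,m₂)), X₋(h(m₁,m₂)) = h(m₁,∇₋m₂) − K²(h(∇₊m₁,m₂)), X_z(h(m₁,m₂)) = h(m₁,∇_zm₂) − K⁴(h(∇_zm₁,m₂)) — and torsion free — meaning ∇₋ω₊ − q²·∇₊ω₋ = ω_z, q²·∇_zω₋ − q⁻²·∇₋ω_z = (1+q²)·ω₋, and q²·∇₊ω_z − q⁻²·∇_zω₊ = (1+q²)·ω₊. -/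
open Finset

section TwistedConnection

variable {A : Type*} [Ring A] [Algebra ℂ A] {n : Type*} [Fintype n]

/-- The connection on the free right module `n → A` with Christoffel symbols `G`: it sends the
`b`-th basis vector to `∑ i, e i * G i b`. -/
def twistedConnection (σ : A →ₐ[ℂ] A) (X : A →ₗ[ℂ] A) (G : Matrix n n A) :
    (n → A) →ₗ[ℂ] (n → A) where
  toFun m i := ∑ j, G i j * σ (m j) + X (m i)
  map_add' m m' := by
    ext i
    simp only [Pi.add_apply, map_add, mul_add, sum_add_distrib]
    abel
  map_smul' c m := by
    ext i
    simp [smul_sum]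

theorem twistedConnection_apply (σ : A →ₐ[ℂ] A) (X : A →ₗ[ℂ] A) (G : Matrix n n A)
    (m : n → A) (i : n) :
    twistedConnection σ X G m i = ∑ j, G i j * σ (m j) + X (m i) := rfl

theorem twistedConnection_leibniz {σ : A →ₐ[ℂ] A} {X : A →ₗ[ℂ] A}
    (hX : ∀ f g, X (f * g) = f * X g + X f * σ g) (G : Matrix n n A) (m : n → A) (f : A) :
    twistedConnection σ X G (fun i => m i * f)
      = (fun i => twistedConnection σ X G m i * σ f) + (fun i => m i * X f) := by
  ext i
  simp only [twistedConnection_apply, Pi.add_apply, map_mul, hX, add_mul, sum_mul, mul_assoc]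
  abel

theorem twistedConnection_single [DecidableEq n] {σ : A →ₐ[ℂ] A} {X : A →ₗ[ℂ] A}
    (hX : ∀ f g, X (f * g) = f * X g + X f * σ g) (G : Matrix n n A) (b : n) :
    twistedConnection σ X G (Pi.single b 1) = fun i => G i b := by
  have h1 : X 1 = 0 := by simpa using hX 1 1
  ext i
  rw [twistedConnection_apply, sum_eq_single b]
  · rcases eq_or_ne i b with rfl | h
    · simp [h1]
    · simp [h]
  · intro j _ hj
    simp [hj]
  · simp

variable [StarRing A]

theorem twistedConnection_compatible {σ : A →ₐ[ℂ] A} {X Y : A →ₗ[ℂ] A}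
    (hσ : ∀ f, σ (star (σ f)) = star f)
    (hX : ∀ f g, X (f * g) = f * X g + X f * σ g)
    (hXY : ∀ f, X (star f) = -σ (star (Y f)))
    {H G G' : Matrix n n A}
    (hH : ∀ a b, X (H a b) = ∑ c, H a c * G c b - σ (∑ c, star (G' c a) * H c b))
    (m₁ m₂ : n → A) :
    X (∑ a, ∑ b, star (m₁ a) * H a b * m₂ b)
      = (∑ a, ∑ b, star (m₁ a) * H a b * twistedConnection σ X G m₂ b)
        - σ (∑ a, ∑ b, star (twistedConnection σ Y G' m₁ a) * H a b * m₂ b) := by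
  have hleft : ∑ a, ∑ b, star (m₁ a) * H a b * twistedConnection σ X G m₂ b
      = ∑ a, ∑ b, (star (m₁ a) * (∑ c, H a c * G c b) * σ (m₂ b)
          + star (m₁ a) * H a b * X (m₂ b)) := by
    simp only [twistedConnection_apply, mul_add, sum_add_distrib, mul_sum, sum_mul, mul_assoc]
    congr 1
    exact sum_congr rfl fun a _ => sum_comm
  have hright : σ (∑ a, ∑ b, star (twistedConnection σ Y G' m₁ a) * H a b * m₂ b)
      = ∑ a, ∑ b, (star (m₁ a) * σ (∑ c, star (G' c a) * H c b) * σ (m₂ b)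
          - X (star (m₁ a)) * σ (H a b) * σ (m₂ b)) := by
    simp only [twistedConnection_apply, star_add, star_sum, star_mul, add_mul, map_add, map_sum,
      map_mul, hσ, sum_add_distrib, mul_sum, sum_mul, mul_assoc, hXY, neg_mul, sub_neg_eq_add]
    congr 1
    calc _ = ∑ a, ∑ c, ∑ b, star (m₁ c) * (σ (star (G' a c)) * (σ (H a b) * σ (m₂ b))) :=
          sum_congr rfl fun a _ => sum_comm
      _ = ∑ c, ∑ a, ∑ b, star (m₁ c) * (σ (star (G' a c)) * (σ (H a b) * σ (m₂ b))) := sum_comm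
      _ = _ := sum_congr rfl fun a _ => sum_comm
  rw [hleft, hright, ← sum_sub_distrib, map_sum]
  refine sum_congr rfl fun a _ => ?_
  rw [← sum_sub_distrib, map_sum]
  refine sum_congr rfl fun b _ => ?_
  rw [hX, hX, hH]
  noncomm_ring

theorem twistedConnection_compatible_of_diagonal [DecidableEq n]
    {σ : A →ₐ[ℂ] A} {X Y : A →ₗ[ℂ] A}
    (hσ : ∀ f, σ (star (σ f)) = star f)
    (hX : ∀ f g, X (f * g) = f * X g + X f * σ g)
    (hXY : ∀ f, X (star f) = -σ (star (Y f)))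
    {H P Q : Matrix n n A} {d : n → A}
    (hoff : ∀ a b, a ≠ b → H a b = 0) (hstar : ∀ a, star (H a a) = H a a)
    (hd : ∀ a, H a a * d a = 1)
    (hH : ∀ a b, X (H a b) = P a b - σ (star (Q b a)))
    (m₁ m₂ : n → A) :
    X (∑ a, ∑ b, star (m₁ a) * H a b * m₂ b)
      = (∑ a, ∑ b, star (m₁ a) * H a b
          * twistedConnection σ X (.of fun a b => d a * P a b) m₂ b)
        - σ (∑ a, ∑ b, star (twistedConnection σ Y (.of fun a b => d a * Q a b) m₁ a)
          * H a b * m₂ b) := by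
  refine twistedConnection_compatible hσ hX hXY (fun a b => ?_) m₁ m₂
  have hd' : star (d b) * H b b = 1 := by
    rw [← star_inj, star_mul, star_star, hstar, hd, star_one]
  rw [hH, sum_eq_single a (fun c _ hc => by rw [hoff a c hc.symm, zero_mul]) (by simp),
    sum_eq_single b (fun c _ hc => by rw [hoff c b hc, mul_zero]) (by simp)]
  simp only [Matrix.of_apply, star_mul]
  rw [← mul_assoc, hd, one_mul, mul_assoc, hd', mul_one]

end TwistedConnection

/-- On the free right `A`-module `Ω` with basis `ω₊, ω₋, ω_z` (encoded as
`Fin 3 → A` with `ω₊ = e₀`, `ω₋ = e₁`, `ω_z = e₂`) equipped with the diagonal hermitian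
form `h(ω₊,ω₊) = q²·h`, `h(ω₋,ω₋) = h`, `h(ω_z,ω_z) = h_z` (with `h, h_z` invertible and
self-adjoint), there exists a triple `(∇₊, ∇₋, ∇_z)` of connections which is compatible
with the hermitian form and torsion free. -/
theorem levi_civita_existence_diagonal_metric
    {A : Type*} [Ring A] [StarRing A] [Algebra ℂ A] [StarModule ℂ A]
    (q : ℝ) (hq0 : q ≠ 0) (hq1 : q ≠ 1) (hqm1 : q ≠ -1)
    (K : A ≃ₐ[ℂ] A) (hKstar : ∀ f : A, star (K f) = K.symm (star f))
    (Xp Xm : A →ₗ[ℂ] A)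
    (hXpLeib : ∀ f g : A, Xp (f * g) = f * Xp g + Xp f * K (K g))
    (hXmLeib : ∀ f g : A, Xm (f * g) = f * Xm g + Xm f * K (K g))
    (hXpstar : ∀ f : A, Xp (star f) = -(K (K (star (Xm f)))))
    (hXmstar : ∀ f : A, Xm (star f) = -(K (K (star (Xp f)))))
    (Xz : A →ₗ[ℂ] A)
    (hXz : ∀ f : A, Xz f = ((1 : ℂ) - ((q : ℂ))⁻¹ ^ 2)⁻¹ • (f - K (K (K (K f)))))
    (hh hz : A)
    (hh_star : star hh = hh) (hz_star : star hz = hz)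
    (hh_unit : IsUnit hh) (hz_unit : IsUnit hz)
    -- the diagonal metric matrix: h₊₊ = q²·h, h₋₋ = h, h_zz = h_z, zero off-diagonal
    (hm : Fin 3 → Fin 3 → A)
    (hm00 : hm 0 0 = (q : ℂ) ^ 2 • hh) (hm11 : hm 1 1 = hh) (hm22 : hm 2 2 = hz)
    (hmoff : ∀ a b : Fin 3, a ≠ b → hm a b = 0) :
    ∃ np nm nz : (Fin 3 → A) →ₗ[ℂ] (Fin 3 → A),
      -- (X₊,K²)-, (X₋,K²)-, (X_z,K⁴)-connections
      (∀ (m : Fin 3 → A) (f : A),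
        np (fun i => m i * f) = (fun i => np m i * K (K f)) + (fun i => m i * Xp f)) ∧
      (∀ (m : Fin 3 → A) (f : A),
        nm (fun i => m i * f) = (fun i => nm m i * K (K f)) + (fun i => m i * Xm f)) ∧
      (∀ (m : Fin 3 → A) (f : A),
        nz (fun i => m i * f) = (fun i => nz m i * K (K (K (K f)))) + (fun i => m i * Xz f)) ∧
      -- compatibility with the hermitian form h
      (∀ m₁ m₂ : Fin 3 → A,
        Xp (∑ a, ∑ b, star (m₁ a) * hm a b * m₂ b)
          = (∑ a, ∑ b, star (m₁ a) * hm a b * np m₂ b)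
            - K (K (∑ a, ∑ b, star (nm m₁ a) * hm a b * m₂ b))) ∧
      (∀ m₁ m₂ : Fin 3 → A,
        Xm (∑ a, ∑ b, star (m₁ a) * hm a b * m₂ b)
          = (∑ a, ∑ b, star (m₁ a) * hm a b * nm m₂ b)
            - K (K (∑ a, ∑ b, star (np m₁ a) * hm a b * m₂ b))) ∧
      (∀ m₁ m₂ : Fin 3 → A,
        Xz (∑ a, ∑ b, star (m₁ a) * hm a b * m₂ b)
          = (∑ a, ∑ b, star (m₁ a) * hm a b * nz m₂ b)
            - K (K (K (K (∑ a, ∑ b, star (nz m₁ a) * hm a b * m₂ b))))) ∧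
      -- torsion freeness
      nm (Pi.single 0 1) - (q : ℂ) ^ 2 • np (Pi.single 1 1) = Pi.single 2 1 ∧
      (q : ℂ) ^ 2 • nz (Pi.single 1 1) - ((q : ℂ))⁻¹ ^ 2 • nm (Pi.single 2 1)
        = (1 + (q : ℂ) ^ 2) • (Pi.single 1 1 : Fin 3 → A) ∧
      (q : ℂ) ^ 2 • np (Pi.single 2 1) - ((q : ℂ))⁻¹ ^ 2 • nz (Pi.single 0 1)
        = (1 + (q : ℂ) ^ 2) • (Pi.single 0 1 : Fin 3 → A) := by
  have hstarK (f : A) : K (star (K f)) = star f := by rw [hKstar, AlgEquiv.apply_symm_apply]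
  let K₂ : A →ₐ[ℂ] A := (K : A →ₐ[ℂ] A).comp K
  let K₄ : A →ₐ[ℂ] A := K₂.comp K₂
  have hK₂ (f : A) : K₂ (star (K₂ f)) = star f := by
    change K (K (star (K (K f)))) = _
    rw [hstarK, hstarK]
  have hK₄ (f : A) : K₄ (star (K₄ f)) = star f := by
    change K₂ (K₂ (star (K₂ (K₂ f)))) = _
    rw [hK₂, hK₂]
  set p : ℂ := (q : ℂ)⁻¹ ^ 2 with hp
  set t : ℂ := (1 - p)⁻¹ with ht
  have hq : (q : ℂ) ≠ 0 := by exact_mod_cast hq0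
  have hp1 : 1 - p ≠ 0 := by
    have hq2 : q ^ 2 ≠ 1 := fun h => (sq_eq_sq_iff_eq_or_eq_neg.mp (h.trans (one_pow 2).symm)).elim hq1 hqm1
    rw [hp, inv_pow, sub_ne_zero, ne_comm, ne_eq, inv_eq_one]
    exact_mod_cast hq2
  have hp_star : star p = p := by simp [hp]
  have ht_star : star t = t := by rw [ht, star_inv₀, star_sub, star_one, hp_star]
  have hqp : (q : ℂ) ^ 2 * p = 1 := by rw [hp]; field_simp
  have htp : t = 1 + t * p := by rw [ht]; field_simp; ring
  clear_value t p
  have hXzLeib (f g : A) : Xz (f * g) = f * Xz g + Xz f * K₄ g := by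
    change _ = f * Xz g + Xz f * K (K (K (K g)))
    simp only [hXz, map_mul, mul_smul_comm, smul_mul_assoc, ← smul_add]
    congr 1
    noncomm_ring
  have hXzstar (f : A) : Xz (star f) = -K₄ (star (Xz f)) := by
    have h4 : Xz = t • (LinearMap.id - K₄.toLinearMap) := LinearMap.ext hXz
    simp only [h4, LinearMap.smul_apply, LinearMap.sub_apply, LinearMap.id_apply,
      AlgHom.toLinearMap_apply, star_smul, ht_star, star_sub, map_smul, map_sub, hK₄, ← smul_neg,
      neg_sub]
  have hXzK (f : A) : Xz f = t • f - t • K₄ f := (hXz f).trans (smul_sub _ _ _)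
  obtain ⟨u, rfl⟩ := hh_unit
  obtain ⟨v, rfl⟩ := hz_unit
  let d : Fin 3 → A := ![p • ↑u⁻¹, ↑u⁻¹, ↑v⁻¹]
  have hd (a : Fin 3) : hm a a * d a = 1 := by
    fin_cases a <;> simp [d, hm00, hm11, hm22, smul_smul, mul_comm p, hqp]
  have hd' (a : Fin 3) : d a * hm a a = 1 := by
    fin_cases a <;> simp [d, hm00, hm11, hm22, smul_smul, hqp]
  have hstar (a : Fin 3) : star (hm a a) = hm a a := by
    fin_cases a <;> simp [hm00, hm11, hm22, hh_star, hz_star]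
  have hXp2 (f : A) : K₂ (star (Xm f)) = -Xp (star f) := by rw [hXpstar, neg_neg]; rfl
  have hXm2 (f : A) : K₂ (star (Xp f)) = -Xm (star f) := by rw [hXmstar, neg_neg]; rfl
  have hK₄' (f : A) : K₄ f = K₂ (K₂ f) := rfl
  -- The lowered Christoffel symbols `hm a a * Γ a b`.
  let P : Matrix (Fin 3) (Fin 3) A :=
    !![Xp (hm 0 0), 0, t • hm 0 0; 0, 0, 0; 0, p • (t • K₂ (hm 0 0) - hm 2 2), 0]
  let M : Matrix (Fin 3) (Fin 3) A :=
    !![0, 0, 0; 0, Xm (hm 1 1), p • (t • hm 0 0 - K₂ (hm 2 2)); t • K₂ (hm 0 0), 0, Xm (hm 2 2)]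
  let Z : Matrix (Fin 3) (Fin 3) A :=
    !![t • hm 0 0, 0, 0; 0, t • hm 1 1 - p ^ 3 • K₂ (hm 2 2), -(p ^ 2 • K₂ (Xp (hm 2 2)));
      0, p ^ 2 • Xm (hm 2 2), t • hm 2 2]
  have hPM (a b : Fin 3) : Xp (hm a b) = P a b - K₂ (star (M b a)) := by
    fin_cases a <;> fin_cases b <;>
      simp [P, M, hmoff, hXp2, hK₂, hstar, ht_star, hp_star, star_smul]
  have hMP (a b : Fin 3) : Xm (hm a b) = M a b - K₂ (star (P b a)) := by
    fin_cases a <;> fin_cases b <;>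
      simp [P, M, hmoff, hXm2, hK₂, hstar, ht_star, hp_star, star_smul]
  have hZ (a b : Fin 3) : Xz (hm a b) = Z a b - K₄ (star (Z b a)) := by
    fin_cases a <;> fin_cases b <;>
      simp [Z, hmoff, hXzK, hXp2, hXm2, hK₂, hK₄', hstar, ht_star, hp_star, star_smul]
  have hT₁ (a : Fin 3) : M a 0 - (q : ℂ) ^ 2 • P a 1 = if a = 2 then hm a a else 0 := by
    fin_cases a <;> simp [P, M, smul_smul, hqp]
  have hT₂ (a : Fin 3) :
      (q : ℂ) ^ 2 • Z a 1 - p • M a 2 = if a = 1 then (1 + (q : ℂ) ^ 2) • hm a a else 0 := by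
    fin_cases a
    · simp [Z, M]
    · simp [Z, M, hm00, hm11]
      match_scalars
      · linear_combination (1 + (q : ℂ) ^ 2) * htp + (t - t * p) * hqp
      · linear_combination -p ^ 2 * hqp
    · simp [Z, M, smul_smul]
      match_scalars
      linear_combination p * hqp
  have hT₃ (a : Fin 3) :
      (q : ℂ) ^ 2 • P a 2 - p • Z a 0 = if a = 0 then (1 + (q : ℂ) ^ 2) • hm a a else 0 := by
    fin_cases a
    · simp [Z, P]
      match_scalars
      linear_combination (1 + (q : ℂ) ^ 2) * htp + t * hqp
    · simp [Z, P]
    · simp [Z, P]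
  refine ⟨twistedConnection K₂ Xp (.of fun a b => d a * P a b),
    twistedConnection K₂ Xm (.of fun a b => d a * M a b),
    twistedConnection K₄ Xz (.of fun a b => d a * Z a b),
    twistedConnection_leibniz hXpLeib _, twistedConnection_leibniz hXmLeib _,
    twistedConnection_leibniz hXzLeib _,
    twistedConnection_compatible_of_diagonal hK₂ hXpLeib hXpstar hmoff hstar hd hPM,
    twistedConnection_compatible_of_diagonal hK₂ hXmLeib hXmstar hmoff hstar hd hMP,
    twistedConnection_compatible_of_diagonal hK₄ hXzLeib hXzstar hmoff hstar hd hZ, ?_, ?_, ?_⟩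
  · rw [twistedConnection_single hXmLeib, twistedConnection_single hXpLeib]
    ext a
    have := congrArg (d a * ·) (hT₁ a)
    simpa [mul_sub, hd', Pi.single_apply] using this
  · rw [twistedConnection_single hXzLeib, twistedConnection_single hXmLeib]
    ext a
    have := congrArg (d a * ·) (hT₂ a)
    simpa [mul_sub, hd', Pi.single_apply] using this
  · rw [twistedConnection_single hXpLeib, twistedConnection_single hXzLeib]
    ext a
    have := congrArg (d a * ·) (hT₃ a)
    simpa [mul_sub, hd', Pi.single_apply] using this
end

section
/- For an integer n ≥ 0, assume q^{2k} ≠ 1 for all 1 ≤ k ≤ n, and for 0 ≤ μ ≤ n set α_{nμ} = ∏_{k=0}^{n−μ−1} (1 − q^{2(n−k)})/(1 − q^{2(k+1)}). Then Σ_{μ=0}^{n} α_{nμ}·(a*)^{μ}(c*)^{n−μ}c^{n−μ}a^{μ} = 1 in A. -/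
open Finset

/-- The Gaussian binomial coefficient `[n choose m]` at `p`, in product form. -/
noncomputable def gaussBinom (p : ℝ) (n m : ℕ) : ℝ :=
  ∏ k ∈ Finset.range m, (1 - p ^ (n - k)) / (1 - p ^ (k + 1))

theorem gaussBinom_zero_right (p : ℝ) (n : ℕ) : gaussBinom p n 0 = 1 := by
  simp [gaussBinom]

theorem gaussBinom_self_succ (p : ℝ) (n : ℕ) : gaussBinom p n (n + 1) = 0 := by
  simp [gaussBinom, Finset.prod_range_succ]

theorem gaussBinom_succ_right (p : ℝ) (n m : ℕ) :
    gaussBinom p n (m + 1) = gaussBinom p n m * ((1 - p ^ (n - m)) / (1 - p ^ (m + 1))) :=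
  Finset.prod_range_succ _ _

theorem gaussBinom_succ_succ_eq_mul (p : ℝ) (n m : ℕ) :
    gaussBinom p (n + 1) (m + 1) = gaussBinom p n m * ((1 - p ^ (n + 1)) / (1 - p ^ (m + 1))) := by
  simp only [gaussBinom, Finset.prod_div_distrib]
  rw [Finset.prod_range_succ', Finset.prod_range_succ (fun k => 1 - p ^ (k + 1)), div_mul_div_comm]
  simp

/-- The `q`-Pascal identity. -/
theorem gaussBinom_succ_succ (p : ℝ) {n m : ℕ} (hm : m ≤ n) (hp : p ^ (m + 1) ≠ 1) :
    gaussBinom p (n + 1) (m + 1) = gaussBinom p n (m + 1) + p ^ (n - m) * gaussBinom p n m := by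
  have hne : 1 - p ^ (m + 1) ≠ 0 := sub_ne_zero.mpr hp.symm
  have hpow : p ^ (n + 1) = p ^ (n - m) * p ^ (m + 1) := by
    rw [← pow_add]
    congr 1
    omega
  rw [gaussBinom_succ_succ_eq_mul, gaussBinom_succ_right, hpow]
  field_simp
  ring

theorem mul_pow_of_smul_comm {A : Type*} [Ring A] [Algebra ℂ A] {z : ℂ} {x y : A}
    (h : x * y = z • (y * x)) (k : ℕ) : x * y ^ k = z ^ k • (y ^ k * x) := by
  induction k with
  | zero => simp
  | succ k ih =>
    rw [pow_succ, ← mul_assoc, ih, smul_mul_assoc, mul_assoc, h, mul_smul_comm, smul_smul,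
      pow_succ, mul_assoc]

/-- If `d * c` commutes with `b` up to the factor `p` and `b * a + d * c = 1`, the weighted sum of
the monomials `b ^ μ * d ^ (n - μ) * c ^ (n - μ) * a ^ μ` is `1`. -/
theorem sum_gaussBinom_smul_eq_one {A : Type*} [Ring A] [Algebra ℂ A] (p : ℝ) {a b c d : A}
    (hcd : c * d = d * c) (hb : d * c * b = (p : ℂ) • (b * (d * c))) (hone : b * a + d * c = 1)
    (n : ℕ) (hp : ∀ k : ℕ, 1 ≤ k → k ≤ n → p ^ k ≠ 1) :
    ∑ μ ∈ Finset.range (n + 1),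
      (gaussBinom p n (n - μ) : ℂ) • (b ^ μ * d ^ (n - μ) * c ^ (n - μ) * a ^ μ) = 1 := by
  have hpow (x : A) (m : ℕ) : x * d ^ m * c ^ m = x * (d * c) ^ m := by
    rw [mul_assoc, Commute.mul_pow hcd.symm]
  simp only [hpow]
  generalize d * c = t at hb hone
  induction n with
  | zero => simp [gaussBinom_zero_right]
  | succ n ih =>
    specialize ih fun k h₁ h₂ => hp k h₁ (h₂.trans n.le_succ)
    have hshift : ∑ μ ∈ Finset.range (n + 1),
        (gaussBinom p n (n - μ) : ℂ) • (b ^ (μ + 1) * t ^ (n - μ) * a ^ (μ + 1)) = b * a := by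
      calc _ = b * 1 * a := by
            rw [← ih, Finset.mul_sum, Finset.sum_mul]
            refine Finset.sum_congr rfl fun μ _ => ?_
            simp only [mul_smul_comm, smul_mul_assoc, pow_succ' b, pow_succ a, mul_assoc]
        _ = b * a := by rw [mul_one]
    have hmul : ∑ μ ∈ Finset.range (n + 1),
        ((p ^ μ * gaussBinom p n (n - μ) : ℝ) : ℂ) • (b ^ μ * t ^ (n - μ + 1) * a ^ μ) = t := by
      calc _ = t * 1 := by
            rw [← ih, Finset.mul_sum]
            refine Finset.sum_congr rfl fun μ _ => ?_
            rw [mul_smul_comm, ← mul_assoc, ← mul_assoc, mul_pow_of_smul_comm hb, smul_mul_assoc,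
              smul_mul_assoc, smul_smul, pow_succ' t, ← mul_assoc]
            push_cast
            rw [mul_comm]
        _ = t := mul_one t
    have hpascal : ∀ μ ∈ Finset.range (n + 1),
        (gaussBinom p (n + 1) (n + 1 - μ) : ℂ) • (b ^ μ * t ^ (n + 1 - μ) * a ^ μ) =
          (gaussBinom p n (n + 1 - μ) : ℂ) • (b ^ μ * t ^ (n + 1 - μ) * a ^ μ) +
          ((p ^ μ * gaussBinom p n (n - μ) : ℝ) : ℂ) • (b ^ μ * t ^ (n - μ + 1) * a ^ μ) := by
      intro μ hμ
      have hle : μ ≤ n := Nat.lt_succ_iff.mp (Finset.mem_range.mp hμ)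
      rw [Nat.succ_sub hle, Nat.succ_eq_add_one,
        gaussBinom_succ_succ p (Nat.sub_le n μ) (hp _ (by omega) (by omega)),
        Nat.sub_sub_self hle, Complex.ofReal_add, add_smul]
    have hlast : gaussBinom p (n + 1) (n + 1 - (n + 1)) = gaussBinom p n (n + 1 - (n + 1)) := by
      simp only [Nat.sub_self, gaussBinom_zero_right]
    rw [Finset.sum_range_succ, Finset.sum_congr rfl hpascal, Finset.sum_add_distrib, hmul, hlast,
      add_right_comm, ← Finset.sum_range_succ (fun μ =>
        (gaussBinom p n (n + 1 - μ) : ℂ) • (b ^ μ * t ^ (n + 1 - μ) * a ^ μ)),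
      Finset.sum_range_succ']
    simp only [Nat.add_sub_add_right, Nat.sub_zero, gaussBinom_self_succ, Complex.ofReal_zero,
      zero_smul, add_zero]
    rw [hshift, hone]

/-- In the quantum 3-sphere algebra, for `n ≥ 0` with `q^{2k} ≠ 1` for
`1 ≤ k ≤ n`, and `α_{nμ} = ∏_{k=0}^{n−μ−1} (1 − q^{2(n−k)})/(1 − q^{2(k+1)})`, one has
`Σ_{μ=0}^{n} α_{nμ}·(a*)^μ(c*)^{n−μ}c^{n−μ}a^μ = 1`. -/
theorem qsphere_Phi_partition_of_unity
    {A : Type*} [Ring A] [StarRing A] [Algebra ℂ A]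
    (q : ℝ) (hq : q ≠ 0)
    (a c : A)
    (hac : a * c = (q : ℂ) • (c * a))
    (hacs : a * star c = (q : ℂ) • (star c * a))
    (hcas : c * star a = (q : ℂ) • (star a * c))
    (hcsas : star c * star a = (q : ℂ) • (star a * star c))
    (hccs : c * star c = star c * c)
    (hunit1 : star a * a + star c * c = 1)
    (hunit2 : a * star a + (q : ℂ) ^ 2 • (c * star c) = 1)
    (n : ℕ) (hqn : ∀ k : ℕ, 1 ≤ k → k ≤ n → q ^ (2 * k) ≠ 1) :
    ∑ μ ∈ Finset.range (n + 1),
      ((((∏ k ∈ Finset.range (n - μ),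
            (1 - q ^ (2 * (n - k))) / (1 - q ^ (2 * (k + 1)))) : ℝ) : ℂ)
        • ((star a) ^ μ * (star c) ^ (n - μ) * c ^ (n - μ) * a ^ μ)) = 1 := by
  have hb : star c * c * star a = ((q ^ 2 : ℝ) : ℂ) • (star a * (star c * c)) := by
    rw [mul_assoc, hcas, mul_smul_comm, ← mul_assoc, hcsas, smul_mul_assoc, smul_smul, mul_assoc]
    push_cast
    rw [pow_two]
  simpa only [gaussBinom, ← pow_mul] using
    sum_gaussBinom_smul_eq_one (q ^ 2) hccs hb hunit1 n
      fun k h₁ h₂ => by simpa only [← pow_mul] using hqn k h₁ h₂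
end

section
/- For an integer n ≥ 0, assume q^{2k} ≠ 1 for all 1 ≤ k ≤ n, and for 0 ≤ μ ≤ n set β_{nμ} = q^{2μ}·∏_{k=0}^{μ−1} (1 − q^{−2(n−k)})/(1 − q^{−2(k+1)}). Then Σ_{μ=0}^{n} β_{nμ}·a^{n−μ}c^{μ}(c*)^{μ}(a*)^{n−μ} = 1 in A. -/
open Finset

/-- The product formula for the Gaussian binomial coefficient in the variable `p`. -/
def gaussianProd {K : Type*} [Field K] (p : K) (n m : ℕ) : K :=
  ∏ k ∈ Finset.range m, (1 - p ^ (n - k)) / (1 - p ^ (k + 1))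

section GaussianProd

variable {K : Type*} [Field K] (p : K)

@[simp]
theorem gaussianProd_zero_right (n : ℕ) : gaussianProd p n 0 = 1 := by
  simp [gaussianProd]

theorem gaussianProd_succ_right (n m : ℕ) :
    gaussianProd p n (m + 1) =
      gaussianProd p n m * ((1 - p ^ (n - m)) / (1 - p ^ (m + 1))) :=
  Finset.prod_range_succ _ _

@[simp]
theorem gaussianProd_self_succ (n : ℕ) : gaussianProd p n (n + 1) = 0 := by
  simp [gaussianProd_succ_right]

theorem gaussianProd_succ_succ (n m : ℕ) :
    gaussianProd p (n + 1) (m + 1) =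
      gaussianProd p n m * ((1 - p ^ (n + 1)) / (1 - p ^ (m + 1))) := by
  simp only [gaussianProd, Finset.prod_div_distrib]
  rw [Finset.prod_range_succ', Finset.prod_range_succ (fun k => 1 - p ^ (k + 1))]
  simp only [Nat.add_sub_add_right, Nat.sub_zero]
  rw [mul_div_mul_comm]

/-- The `p`-Pascal rule. -/
theorem gaussianProd_pascal {n m : ℕ} (hmn : m ≤ n) (hp : p ^ (m + 1) ≠ 1) :
    gaussianProd p (n + 1) (m + 1) =
      gaussianProd p n (m + 1) + p ^ (n - m) * gaussianProd p n m := by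
  have hp' : 1 - p ^ (m + 1) ≠ 0 := sub_ne_zero.mpr hp.symm
  have hpow : p ^ (n + 1) = p ^ (n - m) * p ^ (m + 1) := by
    rw [← pow_add]; congr 1; omega
  rw [gaussianProd_succ_succ, gaussianProd_succ_right, hpow]
  field_simp
  ring

end GaussianProd

section QCommute

variable {K A : Type*} [Field K] [Ring A] [Algebra K A]

theorem pow_mul_of_qcommute {q : K} {x y : A} (h : x * y = q • (y * x)) (m : ℕ) :
    x ^ m * y = q ^ m • (y * x ^ m) := by
  induction m with
  | zero => simp
  | succ m ih =>
    rw [pow_succ, mul_assoc, h, mul_smul_comm, ← mul_assoc, ih, smul_mul_assoc, smul_smul,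
      mul_assoc, ← pow_succ']

theorem mul_pow_of_qcommute {q : K} {x y : A} (h : x * y = q • (y * x)) (m : ℕ) :
    x * y ^ m = q ^ m • (y ^ m * x) := by
  induction m with
  | zero => simp
  | succ m ih =>
    rw [pow_succ, ← mul_assoc, ih, smul_mul_assoc, mul_assoc, h, mul_smul_comm, smul_smul,
      ← mul_assoc, ← pow_succ]

theorem mul_qcommute_word_mul {q : K} (hq : q ≠ 0) {a b c d : A}
    (hac : a * c = q • (c * a)) (hdb : d * b = q • (b * d)) (m k : ℕ) :
    c * (a ^ m * c ^ k * d ^ k * b ^ m) * d =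
      ((q ^ 2)⁻¹) ^ m • (a ^ m * c ^ (k + 1) * d ^ (k + 1) * b ^ m) := by
  have hqm : q ^ m ≠ 0 := pow_ne_zero m hq
  have hca : c * a ^ m = (q ^ m)⁻¹ • (a ^ m * c) := by
    rw [pow_mul_of_qcommute hac, inv_smul_smul₀ hqm]
  have hbd : b ^ m * d = (q ^ m)⁻¹ • (d * b ^ m) := by
    rw [mul_pow_of_qcommute hdb, inv_smul_smul₀ hqm]
  calc c * (a ^ m * c ^ k * d ^ k * b ^ m) * d
      = (c * a ^ m) * c ^ k * d ^ k * (b ^ m * d) := by simp only [mul_assoc]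
    _ = ((q ^ m)⁻¹ * (q ^ m)⁻¹) • ((a ^ m * c) * c ^ k * d ^ k * (d * b ^ m)) := by
      rw [hca, hbd]; simp only [smul_mul_assoc, mul_smul_comm, smul_smul]
    _ = _ := by
      rw [pow_succ' c, pow_succ d]
      simp only [mul_assoc]
      congr 1
      rw [inv_pow, ← mul_inv, ← pow_mul, ← pow_add]
      congr 2
      ring

/-- Expansion of the `n`-fold iterate of `x ↦ a x b + q² c x d` applied to `1`, which fixes `1`. -/
theorem sum_gaussianProd_smul_word_eq_one {q : K} (hq : q ≠ 0) {a b c d : A}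
    (hac : a * c = q • (c * a)) (hdb : d * b = q • (b * d))
    (hunit : a * b + q ^ 2 • (c * d) = 1) (n : ℕ)
    (hqn : ∀ k : ℕ, 1 ≤ k → k ≤ n → ((q ^ 2)⁻¹) ^ k ≠ 1) :
    ∑ k ∈ Finset.range (n + 1),
      ((q ^ 2) ^ k * gaussianProd (q ^ 2)⁻¹ n k) •
        (a ^ (n - k) * c ^ k * d ^ k * b ^ (n - k)) = 1 := by
  induction n with
  | zero => simp
  | succ n ih =>
    replace ih := ih fun k h1 h2 => hqn k h1 (h2.trans n.le_succ)
    have ha : a * b = ∑ k ∈ Finset.range (n + 2),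
        ((q ^ 2) ^ k * gaussianProd (q ^ 2)⁻¹ n k) •
          (a ^ (n + 1 - k) * c ^ k * d ^ k * b ^ (n + 1 - k)) := by
      rw [Finset.sum_range_succ, gaussianProd_self_succ, mul_zero, zero_smul, add_zero]
      conv_lhs => rw [← mul_one a, ← ih, Finset.mul_sum, Finset.sum_mul]
      refine Finset.sum_congr rfl fun k hk => ?_
      rw [Nat.succ_sub (Finset.mem_range_succ_iff.mp hk), pow_succ' a, pow_succ b]
      simp only [mul_smul_comm, smul_mul_assoc, mul_assoc]
    have hc : q ^ 2 • (c * d) = ∑ k ∈ Finset.range (n + 1),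
        ((q ^ 2) ^ (k + 1) * (((q ^ 2)⁻¹) ^ (n - k) * gaussianProd (q ^ 2)⁻¹ n k)) •
          (a ^ (n - k) * c ^ (k + 1) * d ^ (k + 1) * b ^ (n - k)) := by
      conv_lhs => rw [← mul_one c, ← ih, Finset.mul_sum, Finset.sum_mul, Finset.smul_sum]
      refine Finset.sum_congr rfl fun k _ => ?_
      rw [mul_smul_comm, smul_mul_assoc, mul_qcommute_word_mul hq hac hdb, smul_smul, smul_smul]
      congr 1
      ring
    rw [← hunit, ha, hc, Finset.sum_range_succ', Finset.sum_range_succ' _ (n + 1),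
      add_right_comm, ← Finset.sum_add_distrib]
    simp only [gaussianProd_zero_right, Nat.add_sub_add_right]
    congr 1
    refine Finset.sum_congr rfl fun k hk => ?_
    have hkn := Finset.mem_range_succ_iff.mp hk
    rw [← add_smul, ← mul_add,
      gaussianProd_pascal _ hkn (hqn (k + 1) (Nat.le_add_left 1 k) (Nat.succ_le_succ hkn))]

end QCommute

/-- In the quantum 3-sphere algebra, for `n ≥ 0` with `q^{2k} ≠ 1` for
`1 ≤ k ≤ n`, and `β_{nμ} = q^{2μ}·∏_{k=0}^{μ−1} (1 − q^{−2(n−k)})/(1 − q^{−2(k+1)})`,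
one has `Σ_{μ=0}^{n} β_{nμ}·a^{n−μ}c^μ(c*)^μ(a*)^{n−μ} = 1`. -/
theorem qsphere_Psi_partition_of_unity
    {A : Type*} [Ring A] [StarRing A] [Algebra ℂ A]
    (q : ℝ) (hq : q ≠ 0)
    (a c : A)
    (hac : a * c = (q : ℂ) • (c * a))
    (hacs : a * star c = (q : ℂ) • (star c * a))
    (hcas : c * star a = (q : ℂ) • (star a * c))
    (hcsas : star c * star a = (q : ℂ) • (star a * star c))
    (hccs : c * star c = star c * c)
    (hunit1 : star a * a + star c * c = 1)
    (hunit2 : a * star a + (q : ℂ) ^ 2 • (c * star c) = 1)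
    (n : ℕ) (hqn : ∀ k : ℕ, 1 ≤ k → k ≤ n → q ^ (2 * k) ≠ 1) :
    ∑ μ ∈ Finset.range (n + 1),
      ((((q ^ (2 * μ) * ∏ k ∈ Finset.range μ,
            (1 - (q ^ (2 * (n - k)))⁻¹) / (1 - (q ^ (2 * (k + 1)))⁻¹)) : ℝ) : ℂ)
        • (a ^ (n - μ) * c ^ μ * (star c) ^ μ * (star a) ^ (n - μ))) = 1 := by
  have hpow : ∀ k : ℕ, 1 ≤ k → k ≤ n → (((q : ℂ) ^ 2)⁻¹) ^ k ≠ 1 := by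
    intro k h1 h2 h
    rw [inv_pow, inv_eq_one, ← pow_mul] at h
    exact hqn k h1 h2 (by exact_mod_cast h)
  rw [← sum_gaussianProd_smul_word_eq_one (Complex.ofReal_ne_zero.mpr hq) hac hcsas hunit2 n hpow]
  refine Finset.sum_congr rfl fun μ _ => ?_
  congr 1
  simp only [gaussianProd, inv_pow, ← pow_mul]
  push_cast
  rfl
end
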